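/- arXiv:2002.10873 — 2 statements merged into one kernel-verified Lean document; each statement's English description precedes it below -/
import Mathlib

section
/- Let T : [0,1] → [0,1] be a map preserving the probability measure μ = h·Leb, such that for some Λ > 1, T is C¹ with |T'| ≥ Λ on each of finitely many open intervals of monotonicity whose union has full Lebesgue measure. Let f : [0,1] → ℝ be C¹ with 0 < m_f ≤ |f'(x)| ≤ M_f < ∞ for all x, and assume Λ > M_f/m_f. Fix z ∈ [0,1], set f_0 = f(z) and let F = f^{−1}{f_0} (a finite set). Fix k ≥ 0 and assume: h is continuous and strictly positive at every point of F; for every w ∈ F and every 1 ≤ j ≤ k+1, T^j is C¹ on a neighborhood of w; and every point of A_k := {w ∈ F : f(T^j w) ≠ f_0 for all 1 ≤ j ≤ k, and f(T^{k+1}w) = f_0} satisfies T^{k+1}(w) = w. Then lim_{r→0⁺} q_k(r) = Σ_{w ∈ A_k} (1/|(T^{k+1})'(w)|) · (1 + (|f'(w)|/h(w)) · Σ_{y ∈ F, y ≠ w} h(y)/|f'(y)|)^{−1}, where q_k(r) = μ(f^{−1}B(f_0,r) ∩ ⋂_{j=1}^{k} T^{−j}(f^{−1}B(f_0,r))^c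 ∩ T^{−(k+1)}f^{−1}B(f_0,r)) / μ(f^{−1}B(f_0,r)); in particular the limit is 0 when A_k = ∅. -/
open MeasureTheory Set Filter Topology
open scoped ENNReal

/-- A point of the unit interval sees a one- or two-sided neighbourhood of it. -/
lemma exists_volume_real_ball_inter_Icc {z : ℝ} (hz : z ∈ Icc (0 : ℝ) 1) :
    ∃ c > (0 : ℝ), ∀ᶠ ρ in 𝓝[>] (0 : ℝ),
      volume.real (Metric.ball z ρ ∩ Icc 0 1) = c * ρ := by
  rcases eq_or_lt_of_le hz.1 with h0 | h0
  · refine ⟨1, one_pos, ?_⟩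
    filter_upwards [Ioo_mem_nhdsGT one_pos] with ρ hρ
    have : Metric.ball z ρ ∩ Icc 0 1 = Ico 0 ρ := by
      ext x
      simp only [Real.ball_eq_Ioo, mem_inter_iff, mem_Ioo, mem_Icc, mem_Ico] at *
      grind
    rw [this, Real.volume_real_Ico_of_le hρ.1.le]; ring
  rcases eq_or_lt_of_le hz.2 with h1 | h1
  · refine ⟨1, one_pos, ?_⟩
    filter_upwards [Ioo_mem_nhdsGT one_pos] with ρ hρ
    have : Metric.ball z ρ ∩ Icc 0 1 = Ioc (1 - ρ) 1 := by
      ext x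
      simp only [Real.ball_eq_Ioo, mem_inter_iff, mem_Ioo, mem_Icc, mem_Ioc] at *
      grind
    rw [this, Real.volume_real_Ioc_of_le (by linarith [hρ.1])]; ring
  · refine ⟨2, two_pos, ?_⟩
    filter_upwards [Ioo_mem_nhdsGT (lt_min h0 (sub_pos.2 h1))] with ρ hρ
    have hρ1 := hρ.2.trans_le (min_le_left _ _)
    have hρ2 := hρ.2.trans_le (min_le_right _ _)
    have : Metric.ball z ρ ∩ Icc 0 1 = Ioo (z - ρ) (z + ρ) := by
      ext x
      simp only [Real.ball_eq_Ioo, mem_inter_iff, mem_Ioo, mem_Icc] at *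
      grind
    rw [this, Real.volume_real_Ioo_of_le (by linarith [hρ.1])]; ring

/-- A density that is continuous and positive at `z` gives small balls about `z` a mass
asymptotically proportional to their radius. -/
lemma exists_tendsto_measureReal_ball_div {h : ℝ → ℝ} {μ : Measure ℝ}
    (hμ : μ = (volume.restrict (Icc 0 1)).withDensity fun x => ENNReal.ofReal (h x))
    {z : ℝ} (hz : z ∈ Icc (0 : ℝ) 1) (hc : ContinuousAt h z) (hpos : 0 < h z) :
    ∃ L > (0 : ℝ), Tendsto (fun ρ => μ.real (Metric.ball z ρ) / ρ) (𝓝[>] 0) (𝓝 L) := by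
  obtain ⟨c, hc0, hvol⟩ := exists_volume_real_ball_inter_Icc hz
  have hμball : ∀ ρ, μ (Metric.ball z ρ) =
      ∫⁻ x in Metric.ball z ρ ∩ Icc 0 1, ENNReal.ofReal (h x) := fun ρ => by
    rw [hμ, withDensity_apply _ Metric.isOpen_ball.measurableSet,
      Measure.restrict_restrict Metric.isOpen_ball.measurableSet]
  have hmeas : ∀ ρ, MeasurableSet (Metric.ball z ρ ∩ Icc 0 1) := fun ρ =>
    Metric.isOpen_ball.measurableSet.inter measurableSet_Icc
  have hfin : ∀ ρ, volume (Metric.ball z ρ ∩ Icc 0 1) ≠ ⊤ := fun ρ =>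
    ((measure_mono inter_subset_left).trans_lt Metric.isBounded_ball.measure_lt_top).ne
  have hbounds : ∀ a < h z, 0 < a → ∀ᶠ ρ in 𝓝[>] (0 : ℝ), a * c * ρ ≤ μ.real (Metric.ball z ρ) ∧
      ∀ b > h z, (∀ x ∈ Metric.ball z ρ, h x < b) → μ.real (Metric.ball z ρ) ≤ b * c * ρ := by
    intro a ha ha0
    obtain ⟨δ, hδ, hball⟩ := Metric.eventually_nhds_iff_ball.1
      ((hc.eventually_lt_const (lt_add_one (h z))).and (hc.eventually_const_lt ha))
    filter_upwards [hvol, Ioo_mem_nhdsGT hδ] with ρ hρ hρδ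
    have hup : ∀ b > h z, (∀ x ∈ Metric.ball z ρ, h x < b) →
        μ (Metric.ball z ρ) ≤ ENNReal.ofReal b * volume (Metric.ball z ρ ∩ Icc 0 1) := by
      intro b hb hx
      rw [hμball, ← setLIntegral_const]
      exact setLIntegral_mono' (hmeas ρ) fun x hx' => ENNReal.ofReal_le_ofReal (hx x hx'.1).le
    have htop : μ (Metric.ball z ρ) ≠ ⊤ :=
      ((hup _ (lt_add_one _) fun x hx =>
        (hball x (Metric.ball_subset_ball hρδ.2.le hx)).1).trans_lt
        (ENNReal.mul_lt_top ENNReal.ofReal_lt_top (hfin ρ).lt_top)).ne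
    constructor
    · have : ENNReal.ofReal a * volume (Metric.ball z ρ ∩ Icc 0 1) ≤ μ (Metric.ball z ρ) := by
        rw [hμball, ← setLIntegral_const]
        exact setLIntegral_mono' (hmeas ρ) fun x hx' => ENNReal.ofReal_le_ofReal
          (hball x (Metric.ball_subset_ball hρδ.2.le hx'.1)).2.le
      have := ENNReal.toReal_mono htop this
      rw [ENNReal.toReal_mul, ENNReal.toReal_ofReal ha0.le] at this
      rw [mul_assoc, ← hρ]; exact this
    · intro b hb hx
      have := ENNReal.toReal_mono
        (ENNReal.mul_lt_top ENNReal.ofReal_lt_top (hfin ρ).lt_top).ne (hup b hb hx)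
      rw [ENNReal.toReal_mul, ENNReal.toReal_ofReal (hpos.trans hb).le] at this
      rw [mul_assoc, ← hρ]; exact this
  refine ⟨h z * c, by positivity, tendsto_order.2 ⟨fun t ht => ?_, fun t ht => ?_⟩⟩
  · obtain ⟨a, ha1, ha2⟩ := exists_between (max_lt ((div_lt_iff₀ hc0).2 ht) hpos)
    filter_upwards [hbounds a ha2 ((le_max_right _ _).trans_lt ha1), self_mem_nhdsWithin]
      with ρ hρ hρ0
    have : t < a * c := (div_lt_iff₀ hc0).1 ((le_max_left _ _).trans_lt ha1)
    exact this.trans_le ((le_div_iff₀ hρ0).2 hρ.1)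
  · obtain ⟨b, hb1, hb2⟩ := exists_between ((lt_div_iff₀ hc0).2 ht)
    obtain ⟨δ, hδ, hball⟩ := Metric.eventually_nhds_iff_ball.1 (hc.eventually_lt_const hb1)
    filter_upwards [hbounds (h z / 2) (by linarith) (by linarith), Ioo_mem_nhdsGT hδ]
      with ρ hρ hρδ
    have := hρ.2 b hb1 fun x hx => hball x (Metric.ball_subset_ball hρδ.2.le hx)
    exact ((div_le_iff₀ hρδ.1).2 this).trans_lt ((lt_div_iff₀ hc0).1 hb2)

/-- Sets squeezed between balls of radius asymptotic to `r / d` have the mass of such balls. -/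
lemma tendsto_measureReal_div_of_ball_squeeze {μ : Measure ℝ} [IsFiniteMeasure μ] {z L d : ℝ}
    (hd : 0 < d)
    (hL : Tendsto (fun ρ => μ.real (Metric.ball z ρ) / ρ) (𝓝[>] 0) (𝓝 L))
    {X : ℝ → Set ℝ}
    (hupper : ∀ c, 0 < c → c < d → ∀ᶠ r in 𝓝[>] (0 : ℝ), X r ⊆ Metric.ball z (r / c))
    (hlower : ∀ c, d < c → ∀ᶠ r in 𝓝[>] (0 : ℝ), Metric.ball z (r / c) ⊆ X r) :
    Tendsto (fun r => μ.real (X r) / r) (𝓝[>] 0) (𝓝 (L / d)) := by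
  have hscale : ∀ c > 0,
      Tendsto (fun r => μ.real (Metric.ball z (r / c)) / r) (𝓝[>] 0) (𝓝 (L / c)) := by
    intro c hc
    have hr : Tendsto (fun r : ℝ => r / c) (𝓝[>] 0) (𝓝[>] 0) := by
      refine tendsto_nhdsWithin_iff.2 ⟨?_, ?_⟩
      · have : Tendsto (fun r : ℝ => r / c) (𝓝 0) (𝓝 (0 / c)) := tendsto_id.div_const c
        rw [zero_div] at this
        exact this.mono_left nhdsWithin_le_nhds
      · filter_upwards [self_mem_nhdsWithin] with r hr
        exact div_pos hr hc
    refine ((hL.comp hr).div_const c).congr' ?_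
    filter_upwards [self_mem_nhdsWithin] with r hr
    have : r ≠ 0 := (mem_Ioi.1 hr).ne'
    simp only [Function.comp]
    field_simp
  have hcont : Tendsto (fun c => L / c) (𝓝 d) (𝓝 (L / d)) :=
    tendsto_const_nhds.div tendsto_id hd.ne'
  refine tendsto_order.2 ⟨fun t ht => ?_, fun t ht => ?_⟩
  · obtain ⟨c, hct, hcd⟩ := (((hcont.eventually_const_lt ht).filter_mono
      nhdsWithin_le_nhds).and (self_mem_nhdsWithin : Ioi d ∈ 𝓝[>] d)).exists
    filter_upwards [hlower c hcd, (hscale c (hd.trans hcd)).eventually_const_lt hct,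
      self_mem_nhdsWithin] with r hr hr' hr0
    exact hr'.trans_le (div_le_div_of_nonneg_right (measureReal_mono hr) (le_of_lt hr0))
  · obtain ⟨c, hct, hc0, hcd⟩ := (((hcont.eventually_lt_const ht).filter_mono
      nhdsWithin_le_nhds).and (Ioo_mem_nhdsLT hd)).exists
    filter_upwards [hupper c hc0 hcd, (hscale c hc0).eventually_lt_const hct,
      self_mem_nhdsWithin] with r hr hr' hr0
    exact (div_le_div_of_nonneg_right (measureReal_mono hr) (le_of_lt hr0)).trans_lt hr'

lemma HasDerivAt.eventually_mul_abs_sub_le {G : ℝ → ℝ} {d z c : ℝ} (hG : HasDerivAt G d z)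
    (hc : c < |d|) : ∀ᶠ x in 𝓝 z, c * |x - z| ≤ |G x - G z| := by
  filter_upwards [(hasDerivAt_iff_isLittleO.1 hG).def (sub_pos.2 hc)] with x hx
  simp only [smul_eq_mul, Real.norm_eq_abs] at hx
  have h1 := abs_sub_abs_le_abs_sub ((x - z) * d) (G x - G z)
  rw [abs_sub_comm _ (G x - G z), abs_mul] at h1
  nlinarith

lemma HasDerivAt.eventually_abs_sub_le_mul {G : ℝ → ℝ} {d z c : ℝ} (hG : HasDerivAt G d z)
    (hc : |d| < c) : ∀ᶠ x in 𝓝 z, |G x - G z| ≤ c * |x - z| := by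
  filter_upwards [(hasDerivAt_iff_isLittleO.1 hG).def (sub_pos.2 hc)] with x hx
  simp only [smul_eq_mul, Real.norm_eq_abs] at hx
  have h1 := abs_sub_abs_le_abs_sub (G x - G z) ((x - z) * d)
  rw [abs_mul] at h1
  nlinarith

/-- A lower bound on the derivative gives a global expansion bound. -/
lemma mul_abs_sub_le_of_le_abs_deriv {f f' : ℝ → ℝ} {m : ℝ}
    (hf : ∀ x, HasDerivAt f (f' x) x) (hm : ∀ x, m ≤ |f' x|) (x y : ℝ) :
    m * |x - y| ≤ |f x - f y| := by
  wlog hxy : x < y generalizing x y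
  · rcases eq_or_lt_of_le (not_lt.1 hxy) with rfl | hlt
    · simp
    · rw [abs_sub_comm x, abs_sub_comm (f x)]
      exact this y x hlt
  obtain ⟨c, -, hc⟩ := exists_hasDerivAt_eq_slope f f' hxy
    (fun t _ => (hf t).continuousAt.continuousWithinAt) fun t _ => hf t
  rw [eq_div_iff (sub_pos.2 hxy).ne'] at hc
  rw [abs_sub_comm x, abs_sub_comm (f x), ← hc, abs_mul]
  exact mul_le_mul_of_nonneg_right (hm c) (abs_nonneg _)

/-- Along an orbit staying where `|T'| ≥ Λ`, the iterates expand exponentially. -/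
lemma exists_hasDerivAt_iterate_of_orbit {T T' : ℝ → ℝ} {Λ : ℝ} (hΛ : 0 ≤ Λ) {J : Set ℝ}
    (hT : ∀ x ∈ J, HasDerivAt T (T' x) x) (hexp : ∀ x ∈ J, Λ ≤ |T' x|) {x : ℝ} (j : ℕ)
    (hx : ∀ i < j, T^[i] x ∈ J) : ∃ d, HasDerivAt (T^[j]) d x ∧ Λ ^ j ≤ |d| := by
  induction j with
  | zero => exact ⟨1, by simpa using hasDerivAt_id x, by simp⟩
  | succ j ih =>
    obtain ⟨d, hd, hle⟩ := ih fun i hi => hx i (hi.trans (Nat.lt_succ_self j))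
    have hj := hx j (Nat.lt_succ_self j)
    refine ⟨T' (T^[j] x) * d, ?_, ?_⟩
    · rw [Function.iterate_succ']
      exact (hT _ hj).comp x hd
    · rw [pow_succ', abs_mul]
      exact mul_le_mul (hexp _ hj) hle (pow_nonneg hΛ j) (abs_nonneg _)

/-- At a point charged by an invariant measure, a continuous derivative of `T^[j]` inherits
the expansion bound which holds on a set of full measure. -/
lemma pow_le_abs_deriv_iterate {T T' : ℝ → ℝ} {Λ : ℝ} (hΛ : 0 ≤ Λ) {μ : Measure ℝ}
    (hpres : MeasurePreserving T μ μ) {J : Set ℝ} (hJ : MeasurableSet J) (hJμ : μ Jᶜ = 0)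
    (hT : ∀ x ∈ J, HasDerivAt T (T' x) x) (hexp : ∀ x ∈ J, Λ ≤ |T' x|) {z : ℝ}
    (hz : ∀ U ∈ 𝓝 z, μ U ≠ 0) {j : ℕ} {D : ℝ → ℝ}
    (hD : ∀ᶠ x in 𝓝 z, HasDerivAt (T^[j]) (D x) x) (hDc : ContinuousAt D z) :
    Λ ^ j ≤ |D z| := by
  have hnull : μ {x | ∀ i < j, T^[i] x ∈ J}ᶜ = 0 := by
    have : {x | ∀ i < j, T^[i] x ∈ J}ᶜ ⊆ ⋃ i, T^[i] ⁻¹' Jᶜ := by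
      intro x hx
      simp only [mem_compl_iff, mem_ofPred_eq, not_forall] at hx
      obtain ⟨i, -, hi⟩ := hx
      exact mem_iUnion.2 ⟨i, hi⟩
    refine measure_mono_null this (measure_iUnion_null fun i => ?_)
    rw [(hpres.iterate i).measure_preimage hJ.compl.nullMeasurableSet, hJμ]
  have hfreq : ∃ᶠ x in 𝓝 z, ∀ i < j, T^[i] x ∈ J := fun hev => hz _ hev hnull
  refine ge_of_tendsto_of_frequently hDc.abs ((hfreq.and_eventually hD).mono ?_)
  rintro x ⟨hx, hdx⟩
  obtain ⟨d, hd, hle⟩ := exists_hasDerivAt_iterate_of_orbit hΛ hT hexp j hx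
  rwa [hdx.unique hd]

/-- General formula for the quantities `q_k` of the extremal index, for a piecewise
uniformly expanding map `T` of `[0,1]` and a `C¹` observable `f` with derivative bounded
away from zero and infinity. -/
theorem extremal_index_general_formula
    (T h f : ℝ → ℝ) (Λ : ℝ) (hΛ1 : 1 < Λ)
    (Leb : Measure ℝ) (hLeb : Leb = volume.restrict (Set.Icc 0 1))
    (μ : Measure ℝ) (hμ : μ = Leb.withDensity (fun x => ENNReal.ofReal (h x)))
    (hprob : IsProbabilityMeasure μ)
    (hTmeas : Measurable T) (hTmaps : Set.MapsTo T (Set.Icc 0 1) (Set.Icc 0 1))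
    (hinv : ∀ A : Set ℝ, MeasurableSet A → μ (T ⁻¹' A) = μ A)
    -- finitely many open intervals of monotonicity, of full measure in `[0,1]`,
    -- on which `T` is `C¹` with `|T'| ≥ Λ`
    (m : ℕ) (I : Fin m → Set ℝ)
    (hIopen : ∀ i, ∃ a b : ℝ, I i = Set.Ioo a b)
    (hIsub : ∀ i, I i ⊆ Set.Icc 0 1)
    (hIfull : volume (Set.Icc 0 1 \ ⋃ i, I i) = 0)
    (T' : ℝ → ℝ)
    (hTdiff : ∀ i, ∀ x ∈ I i, HasDerivAt T (T' x) x)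
    (hT'cont : ∀ i, ContinuousOn T' (I i))
    (hTexp : ∀ i, ∀ x ∈ I i, Λ ≤ |T' x|)
    (hTmono : ∀ i, StrictMonoOn T (I i) ∨ StrictAntiOn T (I i))
    -- `f` is `C¹` with `0 < m_f ≤ |f'| ≤ M_f < ∞`, and `Λ > M_f / m_f`
    (f' : ℝ → ℝ) (hfdiff : ∀ x, HasDerivAt f (f' x) x) (hf'cont : Continuous f')
    (mf Mf : ℝ) (hmf : 0 < mf)
    (hfb : ∀ x, mf ≤ |f' x| ∧ |f' x| ≤ Mf)
    (hΛf : Mf / mf < Λ)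
    -- the target point `z`, the value `f₀` and the finite set `F` of preimages of `f₀`
    (z : ℝ) (hz : z ∈ Set.Icc (0:ℝ) 1) (f₀ : ℝ) (hf₀ : f₀ = f z)
    (F : Set ℝ) (hF : F = Set.Icc 0 1 ∩ f ⁻¹' {f₀}) (hFfin : F.Finite)
    (k : ℕ)
    -- the density `h` is continuous and positive at every point of `F`
    (hhF : ∀ w ∈ F, ContinuousAt h w ∧ 0 < h w)
    -- for every `w ∈ F` and `1 ≤ j ≤ k+1`, `T^j` is `C¹` on a neighborhood of `w`,
    -- with derivative `DT · j`
    (DT : ℝ → ℕ → ℝ)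
    (hDT : ∀ w ∈ F, ∀ j, 1 ≤ j → j ≤ k + 1 →
      (∃ ε > (0:ℝ), ∀ x ∈ Metric.ball w ε, HasDerivAt (T^[j]) (DT x j) x) ∧
        ContinuousAt (fun x => DT x j) w)
    -- the set `A_k` of preimages returning exactly at time `k+1`
    (A : Set ℝ)
    (hA : A = {w ∈ F | (∀ j, 1 ≤ j → j ≤ k → f (T^[j] w) ≠ f₀) ∧ f (T^[k+1] w) = f₀})
    -- every point of `A_k` is periodic of period `k+1`
    (hAper : ∀ w ∈ A, T^[k+1] w = w) :
    Tendsto (fun r : ℝ =>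
        (μ (f ⁻¹' Metric.ball f₀ r ∩
            (⋂ j ∈ Finset.Icc 1 k, T^[j] ⁻¹' (f ⁻¹' Metric.ball f₀ r)ᶜ) ∩
            T^[k+1] ⁻¹' (f ⁻¹' Metric.ball f₀ r))).toReal /
          (μ (f ⁻¹' Metric.ball f₀ r)).toReal)
      (𝓝[>] 0)
      (nhds (∑ᶠ w ∈ A, (1 / |DT w (k+1)|) *
        (1 + (|f' w| / h w) * ∑ᶠ y ∈ F \ {w}, h y / |f' y|)⁻¹)) := by
  have hinj := mul_abs_sub_le_of_le_abs_deriv hfdiff fun x => (hfb x).1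
  have hfeq : ∀ x, f x = f₀ → x = z := by
    intro x hx
    have h1 := hinj x z
    rw [hx, hf₀, sub_self, abs_zero] at h1
    have h2 : |x - z| = 0 := le_antisymm (by nlinarith [abs_nonneg (x - z)]) (abs_nonneg _)
    exact sub_eq_zero.1 (abs_eq_zero.1 h2)
  have hFz : F = {z} := by
    rw [hF]
    ext x
    simp only [mem_inter_iff, mem_preimage, mem_singleton_iff]
    exact ⟨fun hx => hfeq x hx.2, fun hx => by subst hx; exact ⟨hz, hf₀.symm⟩⟩
  have hzF : z ∈ F := hFz ▸ mem_singleton z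
  subst hLeb
  obtain ⟨L, hL0, hL⟩ := exists_tendsto_measureReal_ball_div hμ hz (hhF z hzF).1 (hhF z hzF).2
  have hcharge : ∀ U ∈ 𝓝 z, μ U ≠ 0 := by
    intro U hU h0
    obtain ⟨δ, hδ, hball⟩ := Metric.mem_nhds_iff.1 hU
    obtain ⟨ρ, hρ, hρδ⟩ := ((hL.eventually_const_lt hL0).and (Ioo_mem_nhdsGT hδ)).exists
    have : μ (Metric.ball z ρ) = 0 :=
      measure_mono_null ((Metric.ball_subset_ball hρδ.2.le).trans hball) h0
    simp [Measure.real, this] at hρ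
  have hpres : MeasurePreserving T μ μ :=
    ⟨hTmeas, Measure.ext fun s hs => by rw [Measure.map_apply hTmeas hs, hinv s hs]⟩
  have hJ : MeasurableSet (⋃ i, I i) := MeasurableSet.iUnion fun i => by
    obtain ⟨a, b, hab⟩ := hIopen i
    exact hab ▸ measurableSet_Ioo
  have hJμ : μ (⋃ i, I i)ᶜ = 0 := by
    rw [hμ]
    refine withDensity_absolutelyContinuous _ _ ?_
    rw [Measure.restrict_apply hJ.compl, inter_comm]
    exact hIfull
  have hderiv : ∀ j, 1 ≤ j → j ≤ k + 1 → HasDerivAt (T^[j]) (DT z j) z := by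
    intro j h1 h2
    obtain ⟨ε, hε, hb⟩ := (hDT z hzF j h1 h2).1
    exact hb z (Metric.mem_ball_self hε)
  have hexpand : ∀ j, 1 ≤ j → j ≤ k + 1 → 1 < |DT z j| := by
    intro j h1 h2
    obtain ⟨⟨ε, hε, hb⟩, hcont⟩ := hDT z hzF j h1 h2
    refine (one_lt_pow₀ hΛ1 (by omega)).trans_le
      (pow_le_abs_deriv_iterate (zero_le_one.trans hΛ1.le) hpres hJ hJμ
        (T' := T') (j := j) (D := fun x => DT x j) ?_ ?_ hcharge ?_ hcont)
    · intro x hx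
      obtain ⟨i, hi⟩ := mem_iUnion.1 hx
      exact hTdiff i x hi
    · intro x hx
      obtain ⟨i, hi⟩ := mem_iUnion.1 hx
      exact hTexp i x hi
    · exact Metric.eventually_nhds_iff_ball.2 ⟨ε, hε, hb⟩
  have hf'z : 0 < |f' z| := hmf.trans_le (hfb z).1
  have hlocal : ∀ P : ℝ → Prop, (∀ᶠ x in 𝓝 z, P x) →
      ∀ᶠ r in 𝓝[>] (0 : ℝ), ∀ x ∈ f ⁻¹' Metric.ball f₀ r, P x := by
    intro P hP
    obtain ⟨δ, hδ, hball⟩ := Metric.eventually_nhds_iff_ball.1 hP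
    filter_upwards [Ioo_mem_nhdsGT (mul_pos hmf hδ)] with r hr x hx
    refine hball x ?_
    rw [mem_preimage, Metric.mem_ball, Real.dist_eq, hf₀] at hx
    rw [Metric.mem_ball, Real.dist_eq]
    exact lt_of_mul_lt_mul_left (((hinj x z).trans_lt hx).trans hr.2) hmf.le
  have hball : ∀ P : ℝ → Prop, (∀ᶠ x in 𝓝 z, P x) → ∀ c > 0,
      ∀ᶠ r in 𝓝[>] (0 : ℝ), ∀ x ∈ Metric.ball z (r / c), P x := by
    intro P hP c hc
    obtain ⟨δ, hδ, hball⟩ := Metric.eventually_nhds_iff_ball.1 hP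
    filter_upwards [Ioo_mem_nhdsGT (mul_pos hδ hc)] with r hr x hx
    exact hball x (Metric.ball_subset_ball ((div_le_iff₀ hc).2 hr.2.le) hx)
  have hmem : ∀ r x, x ∈ f ⁻¹' Metric.ball f₀ r ↔ |f x - f z| < r := by
    intro r x
    rw [mem_preimage, Metric.mem_ball, Real.dist_eq, hf₀]
  have hden : Tendsto (fun r => μ.real (f ⁻¹' Metric.ball f₀ r) / r) (𝓝[>] 0)
      (𝓝 (L / |f' z|)) := by
    refine tendsto_measureReal_div_of_ball_squeeze hf'z hL (fun c hc0 hc => ?_) fun c hc => ?_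
    · filter_upwards [hlocal _ ((hfdiff z).eventually_mul_abs_sub_le hc)] with r hr x hx
      have h1 := (hr x hx).trans_lt ((hmem r x).1 hx)
      rw [Metric.mem_ball, Real.dist_eq, lt_div_iff₀ hc0]
      linarith
    · have hc0 := hf'z.trans hc
      filter_upwards [hball _ ((hfdiff z).eventually_abs_sub_le_mul hc) c hc0] with r hr x hx
      have h1 := hr x hx
      rw [Metric.mem_ball, Real.dist_eq, lt_div_iff₀ hc0] at hx
      exact (hmem r x).2 (by linarith)
  have hcontf : Continuous f := continuous_iff_continuousAt.2 fun x => (hfdiff x).continuousAt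
  have hcontj : ∀ j, 1 ≤ j → j ≤ k + 1 → ContinuousAt (fun x => f (T^[j] x)) z :=
    fun j h1 h2 => hcontf.continuousAt.comp (hderiv j h1 h2).continuousAt
  have hescape : ∀ j, 1 ≤ j → j ≤ k + 1 → f (T^[j] z) ≠ f₀ → ∃ η > 0, ∀ᶠ x in 𝓝 z,
      η < |f (T^[j] x) - f z| := by
    intro j h1 h2 hne
    have hpos : 0 < |f (T^[j] z) - f z| := abs_pos.2 (sub_ne_zero.2 (hf₀ ▸ hne))
    obtain ⟨η, hη0, hη⟩ := exists_between hpos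
    exact ⟨η, hη0, ((hcontj j h1 h2).sub continuousAt_const).abs.eventually_const_lt hη⟩
  have hfT : ∀ j, 1 ≤ j → j ≤ k + 1 → T^[j] z = z →
      HasDerivAt (fun x => f (T^[j] x)) (f' z * DT z j) z := by
    intro j h1 h2 hfix
    have h3 : HasDerivAt f (f' z) (T^[j] z) := hfix.symm ▸ hfdiff z
    exact h3.comp z (hderiv j h1 h2)
  set X : ℝ → Set ℝ := fun r => f ⁻¹' Metric.ball f₀ r ∩
            (⋂ j ∈ Finset.Icc 1 k, T^[j] ⁻¹' (f ⁻¹' Metric.ball f₀ r)ᶜ) ∩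
            T^[k+1] ⁻¹' (f ⁻¹' Metric.ball f₀ r) with hX
  have hXmem : ∀ r x, x ∈ X r ↔ |f x - f z| < r ∧
      (∀ j, 1 ≤ j → j ≤ k → r ≤ |f (T^[j] x) - f z|) ∧ |f (T^[k+1] x) - f z| < r := by
    intro r x
    simp only [hX, mem_inter_iff, mem_iInter, Finset.mem_Icc, and_imp, and_assoc]
    rw [hmem, mem_preimage, hmem]
    simp only [mem_preimage (s := (f ⁻¹' Metric.ball f₀ r)ᶜ), mem_compl_iff, hmem, not_lt]
  by_cases hzA : z ∈ A
  · have hAz : A = {z} := by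
      refine Subset.antisymm (fun w hw => ?_) (singleton_subset_iff.2 hzA)
      rw [hA] at hw
      exact hFz ▸ hw.1
    have hfix := hAper z hzA
    rw [hA] at hzA
    have hD := hexpand (k + 1) (by omega) le_rfl
    have hfTk := hfT (k + 1) (by omega) le_rfl hfix
    have hpos : 0 < |f' z * DT z (k + 1)| := by rw [abs_mul]; positivity
    have hle : |f' z| ≤ |f' z * DT z (k + 1)| := by rw [abs_mul]; nlinarith
    have hnum : Tendsto (fun r => μ.real (X r) / r) (𝓝[>] 0)
        (𝓝 (L / |f' z * DT z (k + 1)|)) := by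
      refine tendsto_measureReal_div_of_ball_squeeze hpos hL (fun c hc0 hc => ?_) fun c hc => ?_
      · filter_upwards [hlocal _ (hfTk.eventually_mul_abs_sub_le hc)] with r hr x hx
        have hx' := (hXmem r x).1 hx
        have h1 := hr x ((hmem r x).2 hx'.1)
        rw [hfix] at h1
        rw [Metric.mem_ball, Real.dist_eq, lt_div_iff₀ hc0]
        linarith [hx'.2.2]
      · have hc0 := hpos.trans hc
        have hmid : ∀ᶠ r in 𝓝[>] (0 : ℝ), ∀ j ∈ Finset.Icc 1 k,
            ∀ x ∈ Metric.ball z (r / c), r ≤ |f (T^[j] x) - f z| := by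
          refine (Finset.eventually_all _).2 fun j hj => ?_
          rw [Finset.mem_Icc] at hj
          obtain ⟨η, hη, hev⟩ := hescape j hj.1 (by omega) (hzA.2.1 j hj.1 hj.2)
          filter_upwards [hball _ hev c hc0, Ioo_mem_nhdsGT hη] with r hr hrη x hx
          exact hrη.2.le.trans (hr x hx).le
        filter_upwards [hmid, hball _ (hfTk.eventually_abs_sub_le_mul hc) c hc0,
          hball _ ((hfdiff z).eventually_abs_sub_le_mul (hle.trans_lt hc)) c hc0]
          with r hr1 hr2 hr3 x hx
        have h2 := hr2 x hx
        have h3 := hr3 x hx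
        rw [hfix] at h2
        have hx' := hx
        rw [Metric.mem_ball, Real.dist_eq, lt_div_iff₀ hc0] at hx'
        exact (hXmem r x).2 ⟨by linarith,
          fun j h1 h2 => hr1 j (Finset.mem_Icc.2 ⟨h1, h2⟩) x hx, by linarith⟩
    have hquot := hnum.div hden (div_pos hL0 hf'z).ne'
    have hval : (∑ᶠ w ∈ A, (1 / |DT w (k+1)|) *
        (1 + (|f' w| / h w) * ∑ᶠ y ∈ F \ {w}, h y / |f' y|)⁻¹) =
        L / |f' z * DT z (k + 1)| / (L / |f' z|) := by
      rw [hAz, finsum_mem_singleton, hFz, sdiff_self]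
      have h1 : |DT z (k + 1)| ≠ 0 := by positivity
      simp only [finsum_mem_empty, abs_mul]
      field_simp
      simp
    rw [hval]
    refine hquot.congr' ?_
    filter_upwards [self_mem_nhdsWithin] with r hr
    exact div_div_div_cancel_right₀ (mem_Ioi.1 hr).ne' _ _
  · have hAz : A = ∅ := by
      refine eq_empty_of_forall_notMem fun w hw => hzA ?_
      have hw' := hw
      rw [hA] at hw'
      have h1 : w = z := by simpa [hFz] using hw'.1
      exact h1 ▸ hw
    rw [hAz, finsum_mem_empty]
    have hempty : ∀ᶠ r in 𝓝[>] (0 : ℝ), X r = ∅ := by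
      by_cases hret : f (T^[k+1] z) = f₀
      · have hfix := hfeq _ hret
        have hearly : ∃ j, 1 ≤ j ∧ j ≤ k ∧ f (T^[j] z) = f₀ := by
          by_contra! hno
          exact hzA (hA ▸ ⟨hzF, hno, hret⟩)
        obtain ⟨j, h1, h2, hj⟩ := hearly
        have hfixj := hfeq _ hj
        have hsplit : T^[k+1] = T^[k+1-j] ∘ T^[j] := by
          rw [← Function.iterate_add]
          congr 1
          omega
        have hprod : DT z (k+1) = DT z (k+1-j) * DT z j := by
          have h3 : HasDerivAt (T^[k+1-j]) (DT z (k+1-j)) (T^[j] z) :=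
            hfixj.symm ▸ hderiv (k+1-j) (by omega) (by omega)
          have h4 := h3.comp z (hderiv j h1 (by omega))
          rw [← hsplit] at h4
          exact (hderiv (k+1) (by omega) le_rfl).unique h4
        have hDj := hexpand j h1 (by omega)
        have hDrest := hexpand (k+1-j) (by omega) (by omega)
        have hlt : |f' z * DT z j| < |f' z * DT z (k+1)| := by
          rw [hprod, abs_mul, abs_mul, abs_mul]
          have : 0 < |f' z| * |DT z j| := by positivity
          nlinarith
        obtain ⟨c, hc1, hc2⟩ := exists_between hlt
        filter_upwards [
          hlocal _ ((hfT j h1 (by omega) hfixj).eventually_abs_sub_le_mul hc1),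
          hlocal _ ((hfT (k+1) (by omega) le_rfl hfix).eventually_mul_abs_sub_le hc2)]
          with r hr1 hr2
        refine eq_empty_of_forall_notMem fun x hx => ?_
        have hx' := (hXmem r x).1 hx
        have h5 := hr1 x ((hmem r x).2 hx'.1)
        have h6 := hr2 x ((hmem r x).2 hx'.1)
        rw [hfixj] at h5
        rw [hfix] at h6
        linarith [hx'.2.1 j h1 h2, hx'.2.2]
      · obtain ⟨η, hη, hev⟩ := hescape (k+1) (by omega) le_rfl hret
        filter_upwards [hlocal _ hev, Ioo_mem_nhdsGT hη] with r hr hrη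
        refine eq_empty_of_forall_notMem fun x hx => ?_
        have hx' := (hXmem r x).1 hx
        linarith [hr x ((hmem r x).2 hx'.1), hx'.2.2, hrη.2]
    refine tendsto_const_nhds.congr' ?_
    filter_upwards [hempty] with r hr
    change 0 = (μ (X r)).toReal / _
    simp [hr]
end

section
/- Let μ_C denote the ternary Cantor measure on [0,1], defined as the pushforward of the infinite product over ℕ of the uniform Bernoulli measure on {0,1} under the map (a_n)_{n≥1} ↦ Σ_{n≥1} 2a_n 3^{−n}, and let T(x) = 3x mod 1. For r > 0 let S_r = {(x,y) ∈ [0,1]² : x ≤ r}, the r-neighborhood (in the x-coordinate) of the Cantor set placed along the y-axis. Then for every r ∈ (0, 1/3): (μ_C ⊗ μ_C)(S_r ∩ (T×T)^{−1}S_r) = (1/2)·(μ_C ⊗ μ_C)(S_r). Consequently q_0 = lim_{r→0⁺} (μ_C ⊗ μ_C)(S_r ∩ (T×T)^{−1}S_r)/(μ_C ⊗ μ_C)(S_r) = 1/2, and the extremal index for hitting the strip around the Cantor set equals θ = 1 − q_0 = 1/2. -/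
open MeasureTheory Set Filter Topology
open scoped ENNReal

/-- The coding map of the ternary Cantor set: `ω ↦ ∑_{n≥0} 2 ω_n 3^{-(n+1)}`. -/
noncomputable def cantorVal (ω : ℕ → Bool) : ℝ :=
  ∑' n : ℕ, (if ω n then 2 else 0) * (1/3 : ℝ) ^ (n + 1)

theorem cantorVal_term_bounds (ω : ℕ → Bool) (n : ℕ) :
    0 ≤ (if ω n then 2 else 0) * (1/3 : ℝ) ^ (n + 1) ∧
      (if ω n then 2 else 0) * (1/3 : ℝ) ^ (n + 1) ≤ 2 / 3 * (1/3 : ℝ) ^ n := by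
  have h : (0 : ℝ) < (1/3 : ℝ) ^ n := by positivity
  rw [pow_succ]
  split_ifs <;> constructor <;> nlinarith

theorem summable_cantorVal_majorant : Summable fun n : ℕ => 2 / 3 * (1/3 : ℝ) ^ n :=
  (summable_geometric_of_lt_one (by norm_num) (by norm_num)).mul_left _

theorem summable_cantorVal (ω : ℕ → Bool) :
    Summable fun n : ℕ => (if ω n then 2 else 0) * (1/3 : ℝ) ^ (n + 1) :=
  summable_cantorVal_majorant.of_nonneg_of_le (fun n => (cantorVal_term_bounds ω n).1)
    fun n => (cantorVal_term_bounds ω n).2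

theorem cantorVal_nonneg (ω : ℕ → Bool) : 0 ≤ cantorVal ω :=
  tsum_nonneg fun n => (cantorVal_term_bounds ω n).1

theorem cantorVal_le_one (ω : ℕ → Bool) : cantorVal ω ≤ 1 := by
  have h := (summable_cantorVal ω).tsum_le_tsum (fun n => (cantorVal_term_bounds ω n).2)
    summable_cantorVal_majorant
  rw [tsum_mul_left, tsum_geometric_of_lt_one (by norm_num) (by norm_num)] at h
  norm_num at h
  simpa [cantorVal] using h

theorem cantorVal_eq_shift (ω : ℕ → Bool) :
    cantorVal ω = (if ω 0 then 2 else 0) / 3 + cantorVal (fun n => ω (n + 1)) / 3 := by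
  rw [cantorVal, (summable_cantorVal ω).tsum_eq_zero_add, cantorVal, ← tsum_div_const]
  congr 1
  · ring
  · exact tsum_congr fun n => by ring

theorem continuous_cantorVal : Continuous cantorVal := by
  refine continuous_tsum (fun n => ?_) summable_cantorVal_majorant fun n ω => ?_
  · exact (continuous_of_discreteTopology
      (f := fun b : Bool => (if b then 2 else 0) * (1/3 : ℝ) ^ (n + 1))).comp (continuous_apply n)
  · rw [Real.norm_of_nonneg (cantorVal_term_bounds ω n).1]
    exact (cantorVal_term_bounds ω n).2

theorem cantorVal_le_and_fract_le_iff {r : ℝ} (h0 : 0 < r) (h1 : r < 1 / 3) (ω : ℕ → Bool) :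
    (cantorVal ω ≤ r ∧ Int.fract (3 * cantorVal ω) ≤ r) ↔
      ω 0 = false ∧ cantorVal (fun n => ω (n + 1)) ≤ r := by
  have hω := cantorVal_eq_shift ω
  have hs := cantorVal_nonneg fun n => ω (n + 1)
  cases h : ω 0
  · simp only [h, Bool.false_eq_true, if_false] at hω
    have h3 : 3 * cantorVal ω = cantorVal fun n => ω (n + 1) := by linarith
    rw [h3]
    constructor
    · rintro ⟨ha, hb⟩
      rw [Int.fract_eq_self.2 ⟨hs, by linarith⟩] at hb
      exact ⟨rfl, hb⟩
    · rintro ⟨-, hb⟩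
      rw [Int.fract_eq_self.2 ⟨hs, by linarith⟩]
      exact ⟨by linarith, hb⟩
  · simp only [h, if_true] at hω
    simp only [Bool.true_eq_false, false_and, iff_false, not_and]
    intro ha
    linarith

theorem isPiSystem_range_cylinder :
    IsPiSystem {s : Set (ℕ → Bool) | ∃ v n, s = PiNat.cylinder v n} := by
  rintro _ ⟨v, n, rfl⟩ _ ⟨w, m, rfl⟩ ⟨x, hx, hy⟩
  rw [PiNat.mem_cylinder_iff_eq] at hx hy
  rw [← hx, ← hy]
  rcases le_total n m with h | h
  · exact ⟨x, m, inter_eq_right.2 (PiNat.cylinder_anti x h)⟩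
  · exact ⟨x, n, inter_eq_left.2 (PiNat.cylinder_anti x h)⟩

/-- Under the uniform Bernoulli measure, the first digit is independent of the shifted sequence,
which again has the uniform Bernoulli law. -/
theorem bernoulli_zero_shift (bern : Measure (ℕ → Bool))
    (hbern : ∀ (n : ℕ) (v : ℕ → Bool),
      bern {ω | ∀ i < n, ω i = v i} = (1/2 : ℝ≥0∞) ^ n)
    {A : Set (ℕ → Bool)} (hA : MeasurableSet A) :
    bern {ω | ω 0 = false ∧ (fun n => ω (n + 1)) ∈ A} = (1/2 : ℝ≥0∞) * bern A := by
  have huniv : bern univ = 1 := by simpa using hbern 0 fun _ => false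
  have : IsProbabilityMeasure bern := ⟨huniv⟩
  have hshift : Measurable fun (ω : ℕ → Bool) (n : ℕ) => ω (n + 1) :=
    measurable_pi_lambda _ fun n => measurable_pi_apply (n + 1)
  have hE : MeasurableSet {ω : ℕ → Bool | ω 0 = false} :=
    (measurable_pi_apply 0 : Measurable fun ω : ℕ → Bool => ω 0) (measurableSet_singleton false)
  let ν := (bern.restrict {ω : ℕ → Bool | ω 0 = false}).map fun ω n => ω (n + 1)
  have hν : ∀ B, MeasurableSet B → ν B = bern {ω | ω 0 = false ∧ (fun n => ω (n + 1)) ∈ B} := by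
    intro B hB
    rw [Measure.map_apply hshift hB, Measure.restrict_apply (hshift hB), inter_comm]
    rfl
  have hcyl : ∀ (v : ℕ → Bool) (n : ℕ), ν (PiNat.cylinder v n) = (1/2 : ℝ≥0∞) ^ (n + 1) := by
    intro v n
    rw [hν _ (PiNat.isOpen_cylinder _ v n).measurableSet,
      ← hbern (n + 1) fun i => Nat.casesOn i false v]
    congr 1
    ext ω
    simp only [PiNat.cylinder, mem_ofPred_eq]
    exact (Nat.forall_lt_succ_left (p := fun i => ω i = Nat.casesOn i false v)).symm
  have key : ν = (1/2 : ℝ≥0∞) • bern := by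
    refine ext_of_generate_finite _ ?_ isPiSystem_range_cylinder ?_ ?_
    · rw [← (PiNat.isTopologicalBasis_cylinders fun _ : ℕ => Bool).borel_eq_generateFrom]
      exact BorelSpace.measurable_eq
    · rintro _ ⟨v, n, rfl⟩
      rw [hcyl, Measure.smul_apply, PiNat.cylinder, hbern, smul_eq_mul, pow_succ']
    · have h := hcyl (fun _ => false) 0
      rw [PiNat.cylinder_zero] at h
      rw [h, Measure.smul_apply, huniv]
      simp
  rw [← hν A hA, key, Measure.smul_apply, smul_eq_mul]

theorem bernoulli_cantorVal_le_ne_zero (bern : Measure (ℕ → Bool))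
    (hbern : ∀ (n : ℕ) (v : ℕ → Bool),
      bern {ω | ∀ i < n, ω i = v i} = (1/2 : ℝ≥0∞) ^ n)
    {r : ℝ} (hr : 0 < r) : bern {ω | cantorVal ω ≤ r} ≠ 0 := by
  have hpow : ∀ n : ℕ, bern {ω | cantorVal ω ≤ (1/3 : ℝ) ^ n} ≠ 0 := by
    intro n
    induction n with
    | zero =>
      have huniv : bern univ = 1 := by simpa using hbern 0 fun _ => false
      simp [cantorVal_le_one, huniv]
    | succ n ih =>
      have hA : MeasurableSet {ω | cantorVal ω ≤ (1/3 : ℝ) ^ n} :=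
        continuous_cantorVal.measurable measurableSet_Iic
      refine fun h => mul_ne_zero (by simp) ih ((bernoulli_zero_shift bern hbern hA).symm.trans
        (measure_mono_null ?_ h))
      rintro ω ⟨h0, h1⟩
      have hω := cantorVal_eq_shift ω
      simp only [mem_ofPred_eq] at h1 ⊢
      simp only [h0, Bool.false_eq_true, if_false] at hω
      rw [pow_succ]
      linarith
  obtain ⟨n, hn⟩ := exists_pow_lt_of_lt_one hr (by norm_num : (1/3 : ℝ) < 1)
  exact fun h => hpow n (measure_mono_null (fun ω hω => le_trans hω hn.le) h)

/-- For the product system `T × T` with `T x = 3x mod 1` and invariant measure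
`μ_C ⊗ μ_C`, and the strip `S_r = {x ≤ r}` around the Cantor set placed on the `y`-axis,
one has `(μ_C ⊗ μ_C)(S_r ∩ (T×T)⁻¹ S_r) = (1/2)(μ_C ⊗ μ_C)(S_r)` for `0 < r < 1/3`;
hence `q₀ = 1/2` and the extremal index is `θ = 1 - q₀ = 1/2`. -/
theorem cantor_strip_extremal_index_half
    (T : ℝ → ℝ) (hT : ∀ x, T x = Int.fract (3 * x))
    -- the uniform Bernoulli product measure on `{0,1}^ℕ`
    (bern : Measure (ℕ → Bool))
    (hbern : ∀ (n : ℕ) (v : ℕ → Bool),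
      bern {ω | ∀ i < n, ω i = v i} = (1/2 : ℝ≥0∞) ^ n)
    -- the ternary Cantor measure
    (μC : Measure ℝ) (hμC : μC = Measure.map cantorVal bern)
    (S : ℝ → Set (ℝ × ℝ)) (hS : ∀ r : ℝ, S r = {p : ℝ × ℝ | p.1 ≤ r}) :
    (∀ r ∈ Set.Ioo (0:ℝ) (1/3),
      (μC.prod μC) (S r ∩ Prod.map T T ⁻¹' S r) =
        (1/2 : ℝ≥0∞) * (μC.prod μC) (S r)) ∧
    Tendsto (fun r : ℝ =>
        ((μC.prod μC) (S r ∩ Prod.map T T ⁻¹' S r)).toReal /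
          ((μC.prod μC) (S r)).toReal)
      (𝓝[>] 0) (nhds (1/2)) := by
  have huniv : bern univ = 1 := by simpa using hbern 0 fun _ => false
  have : IsProbabilityMeasure bern := ⟨huniv⟩
  have hmeas : Measurable cantorVal := continuous_cantorVal.measurable
  have hprob : IsProbabilityMeasure μC :=
    hμC ▸ Measure.isProbabilityMeasure_map hmeas.aemeasurable
  have hTm : Measurable T := by
    rw [funext hT]
    exact measurable_fract.comp (measurable_const_mul 3)
  have hSr : ∀ r, (μC.prod μC) (S r) = bern {ω | cantorVal ω ≤ r} := by
    intro r
    have h : S r = Iic r ×ˢ univ := by ext; simp [hS]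
    rw [h, Measure.prod_prod, measure_univ, mul_one, hμC, Measure.map_apply hmeas measurableSet_Iic]
    rfl
  have hmain : ∀ r ∈ Set.Ioo (0:ℝ) (1/3), (μC.prod μC) (S r ∩ Prod.map T T ⁻¹' S r) =
      (1/2 : ℝ≥0∞) * (μC.prod μC) (S r) := by
    rintro r ⟨h0, h1⟩
    have h : S r ∩ Prod.map T T ⁻¹' S r = (Iic r ∩ T ⁻¹' Iic r) ×ˢ univ := by ext; simp [hS]
    have hA : MeasurableSet {ω | cantorVal ω ≤ r} := hmeas measurableSet_Iic
    rw [hSr, ← bernoulli_zero_shift bern hbern hA, h, Measure.prod_prod, measure_univ, mul_one, hμC,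
      Measure.map_apply hmeas (measurableSet_Iic.inter (hTm measurableSet_Iic))]
    congr 1
    ext ω
    simpa [hT] using cantorVal_le_and_fract_le_iff h0 h1 ω
  refine ⟨hmain, tendsto_const_nhds.congr' ?_⟩
  filter_upwards [Ioo_mem_nhdsGT (by norm_num : (0 : ℝ) < 1 / 3)] with r hr
  have hne : ((μC.prod μC) (S r)).toReal ≠ 0 := by
    rw [hSr]
    exact ENNReal.toReal_ne_zero.2
      ⟨bernoulli_cantorVal_le_ne_zero bern hbern hr.1, measure_ne_top _ _⟩
  rw [hmain r hr, ENNReal.toReal_mul, mul_div_cancel_right₀ _ hne]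
  simp
end
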